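/- arXiv:2011.12347 — 2 statements merged into one kernel-verified Lean document; each statement's English description precedes it below -/
import Mathlib

section
/- Let X be a topological space, Y a real Hilbert space with inner product ⟨·,·⟩, T ⊆ Y a convex set dense in Y, and I : X → ℝ, φ : X → Y two functions such that, for each y ∈ T, the function x ↦ I(x) + ⟨φ(x), y⟩ is lower semicontinuous and inf-compact. Assume there exists a point x₀ ∈ X with φ(x₀) ≠ 0 such that: (a) x₀ is a global minimum of both the function I and the function x ↦ ‖φ(x)‖; (b) inf_{x ∈ X} ⟨φ(x), φ(x₀)⟩ < ‖φ(x₀)‖². Then, for each convex set S ⊆ T dense in Y, there exists y* ∈ S such that the function x ↦ I(x) + ⟨φ(x), y*⟩ has at least two global minima in X, i.e., there exist x₁ ≠ x₂ in X at which this function attains its infimum over X. -/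
open scoped RealInnerProductSpace

open Filter Topology

/-- A lower semicontinuous inf-compact function on a nonempty space has a global minimum. -/
theorem exists_global_min_of_infCompact {X : Type*} [TopologicalSpace X] [Nonempty X] {g : X → ℝ}
    (hg : LowerSemicontinuous g) (hcpt : ∀ r : ℝ, IsCompact {x | g x ≤ r}) :
    ∃ x, ∀ z, g x ≤ g z := by
  obtain ⟨x₀⟩ := ‹Nonempty X›
  obtain ⟨a, ha, hmin⟩ := LowerSemicontinuousOn.exists_isMinOn (s := {x | g x ≤ g x₀})
    ⟨x₀, le_refl (g x₀)⟩ (hcpt _) (hg.lowerSemicontinuousOn _)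
  refine ⟨a, fun z => ?_⟩
  by_cases hz : g z ≤ g x₀
  · exact hmin hz
  · exact le_trans ha (not_le.mp hz).le

section Minimax

variable {X : Type*} [TopologicalSpace X] {Y : Type*} [NormedAddCommGroup Y] [InnerProductSpace ℝ Y]

/-- If `p` maximizes over the convex set `P` the minimum value `I (ξ y) + ⟪φ (ξ y), y⟫`, and the
minimizer at `p` is unique, then `(ξ p, p)` is a saddle point. -/
theorem le_of_isMaxOn_of_unique_min {I : X → ℝ} {φ : X → Y} {P : Set Y} (hP : Convex ℝ P)
    (hlsc : ∀ y ∈ P, LowerSemicontinuous (fun x : X => I x + ⟪φ x, y⟫))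
    (hcpt : ∀ y ∈ P, ∀ r : ℝ, IsCompact {x : X | I x + ⟪φ x, y⟫ ≤ r})
    {ξ : Y → X} (hξ : ∀ y ∈ P, ∀ x, I (ξ y) + ⟪φ (ξ y), y⟫ ≤ I x + ⟪φ x, y⟫)
    {p : Y} (hp : p ∈ P)
    (hmax : ∀ y ∈ P, I (ξ y) + ⟪φ (ξ y), y⟫ ≤ I (ξ p) + ⟪φ (ξ p), p⟫)
    (huniq : ∀ x, (∀ z, I x + ⟪φ x, p⟫ ≤ I z + ⟪φ z, p⟫) → x = ξ p) {q : Y} (hq : q ∈ P) :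
    I (ξ p) + ⟪φ (ξ p), q⟫ ≤ I (ξ p) + ⟪φ (ξ p), p⟫ := by
  set h := I (ξ p) + ⟪φ (ξ p), p⟫
  set x : ℝ → X := fun t => ξ ((1 - t) • p + t • q)
  have hval : ∀ t ∈ Set.Ioo (0 : ℝ) 1,
      (1 - t) * (I (x t) + ⟪φ (x t), p⟫) + t * (I (x t) + ⟪φ (x t), q⟫) ≤ h := by
    intro t ht
    have := hmax _ (hP hp hq (by linarith [ht.2]) ht.1.le (sub_add_cancel 1 t))
    rw [inner_add_right, real_inner_smul_right, real_inner_smul_right] at this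
    change I (x t) + ((1 - t) * ⟪φ (x t), p⟫ + t * ⟪φ (x t), q⟫) ≤ h at this
    linarith
  have hIoo : ∀ᶠ t in 𝓝[>] (0 : ℝ), t ∈ Set.Ioo (0 : ℝ) 1 := Ioo_mem_nhdsGT one_pos
  have hxq : ∀ᶠ t in 𝓝[>] (0 : ℝ), x t ∈ {z | I z + ⟪φ z, q⟫ ≤ h} := by
    filter_upwards [hIoo] with t ht
    have h1 := hval t ht
    have h2 := mul_le_mul_of_nonneg_left (hξ p hp (x t)) (sub_nonneg.mpr ht.2.le)
    change _ ≤ h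
    refine le_of_mul_le_mul_left ?_ ht.1
    linarith
  obtain ⟨z, hzq, hz⟩ := (hcpt q hq h).exists_mapClusterPt (tendsto_principal.mpr hxq)
  have hzp : I z + ⟪φ z, p⟫ ≤ h := by
    refine le_of_forall_pos_le_add fun ε hε => ?_
    have hsmall : ∀ᶠ t in 𝓝[>] (0 : ℝ),
        t * (h - (I (ξ q) + ⟪φ (ξ q), q⟫)) < (1 - t) * ε := by
      refine Filter.Eventually.filter_mono nhdsWithin_le_nhds ?_
      refine ContinuousAt.eventually_lt (by fun_prop) (by fun_prop) ?_
      simpa using hε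
    have hev : ∀ᶠ t in 𝓝[>] (0 : ℝ), x t ∈ {z | I z + ⟪φ z, p⟫ ≤ h + ε} := by
      filter_upwards [hIoo, hsmall] with t ht hs
      have h1 := hval t ht
      have h2 := mul_le_mul_of_nonneg_left (hξ q hq (x t)) ht.1.le
      change _ ≤ h + ε
      refine le_of_mul_le_mul_left ?_ (sub_pos.mpr ht.2)
      linarith
    have hcl : IsClosed {z | I z + ⟪φ z, p⟫ ≤ h + ε} := (hlsc p hp).isClosed_preimage (h + ε)
    exact hcl.mem_of_mapClusterPt hz hev
  have hzξ : z = ξ p := huniq z fun w => hzp.trans (hξ p hp w)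
  exact hzξ ▸ hzq

/-- Minimax inequality for inf-compact functions with unique minima: if every function
`x ↦ I x + ⟪φ x, y⟫` with `y ∈ K` takes a value at most `c`, then some point works for all `y`. -/
theorem exists_forall_le_of_unique_min [Nonempty X] {I : X → ℝ} {φ : X → Y} {K : Set Y}
    (hK : Convex ℝ K) (hKne : K.Nonempty)
    (hlsc : ∀ y ∈ K, LowerSemicontinuous (fun x : X => I x + ⟪φ x, y⟫))
    (hcpt : ∀ y ∈ K, ∀ r : ℝ, IsCompact {x : X | I x + ⟪φ x, y⟫ ≤ r})
    (huniq : ∀ y ∈ K, ∀ x₁ x₂, (∀ x, I x₁ + ⟪φ x₁, y⟫ ≤ I x + ⟪φ x, y⟫) →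
      (∀ x, I x₂ + ⟪φ x₂, y⟫ ≤ I x + ⟪φ x, y⟫) → x₁ = x₂)
    {c : ℝ} (hc : ∀ y ∈ K, ∃ x, I x + ⟪φ x, y⟫ ≤ c) :
    ∃ x, ∀ y ∈ K, I x + ⟪φ x, y⟫ ≤ c := by
  classical
  have hex : ∀ y, ∃ x, y ∈ K → ∀ z, I x + ⟪φ x, y⟫ ≤ I z + ⟪φ z, y⟫ := by
    intro y
    by_cases hy : y ∈ K
    · obtain ⟨x, hx⟩ := exists_global_min_of_infCompact (hlsc y hy) (hcpt y hy)
      exact ⟨x, fun _ => hx⟩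
    · exact ⟨Classical.arbitrary X, fun h => absurd h hy⟩
  choose ξ hξ using hex
  obtain ⟨y₀, hy₀⟩ := hKne
  have key := (hcpt y₀ hy₀ c).inter_iInter_nonempty
    (fun y : K => {x : X | I x + ⟪φ x, (y : Y)⟫ ≤ c})
    (fun y => (hlsc y y.2).isClosed_preimage c) ?_
  · obtain ⟨x, -, hx⟩ := key
    exact ⟨x, fun y hy => Set.mem_iInter.mp hx ⟨y, hy⟩⟩
  intro u
  set F : Set Y := insert y₀ ((↑) '' (u : Set K))
  have hFK : F ⊆ K := by
    rintro _ (rfl | ⟨y, -, rfl⟩)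
    exacts [hy₀, y.2]
  have hPK : convexHull ℝ F ⊆ K := convexHull_min hFK hK
  have hPcpt : IsCompact (convexHull ℝ F) :=
    Set.Finite.isCompact_convexHull ℝ ((u.finite_toSet.image _).insert y₀)
  have husc : UpperSemicontinuousOn (fun y => I (ξ y) + ⟪φ (ξ y), y⟫) (convexHull ℝ F) := by
    intro y _ b hb
    have hcont : ContinuousAt (fun z => I (ξ y) + ⟪φ (ξ y), z⟫) y := by fun_prop
    filter_upwards [self_mem_nhdsWithin, nhdsWithin_le_nhds (hcont.eventually_lt_const hb)]
      with z hz hzb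
    exact (hξ z (hPK hz) _).trans_lt hzb
  obtain ⟨p, hp, hmax⟩ := husc.exists_isMaxOn
    ⟨y₀, subset_convexHull ℝ F (Set.mem_insert _ _)⟩ hPcpt
  have hle : ∀ q ∈ F, I (ξ p) + ⟪φ (ξ p), q⟫ ≤ c := by
    intro q hq
    obtain ⟨x, hx⟩ := hc p (hPK hp)
    exact (le_of_isMaxOn_of_unique_min (convex_convexHull ℝ F) (fun y hy => hlsc y (hPK hy))
      (fun y hy => hcpt y (hPK hy)) (fun y hy => hξ y (hPK hy)) hp (fun y hy => hmax hy)
      (fun x hx => huniq p (hPK hp) _ _ hx (hξ p (hPK hp)))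
      (subset_convexHull ℝ F hq)).trans ((hξ p (hPK hp) x).trans hx)
  refine ⟨ξ p, hle y₀ (Set.mem_insert _ _), Set.mem_iInter₂.mpr fun y hy => ?_⟩
  exact hle y (Set.mem_insert_of_mem _ ⟨y, hy, rfl⟩)

end Minimax

section Hilbert

variable {Y : Type*} [NormedAddCommGroup Y] [InnerProductSpace ℝ Y]

/-- Moving from `a` towards `b` decreases the norm at first when `⟪b, a⟫ < ‖a‖ ^ 2`. -/
theorem exists_norm_segment_lt {a b : Y} (h : ⟪b, a⟫ < ‖a‖ ^ 2) :
    ∃ t ∈ Set.Ioo (0 : ℝ) 1, ‖(1 - t) • a + t • b‖ < ‖a‖ := by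
  have hsmall : ∀ᶠ t in 𝓝[>] (0 : ℝ), 2 * (⟪b, a⟫ - ‖a‖ ^ 2) + t * ‖b - a‖ ^ 2 < 0 := by
    refine Filter.Eventually.filter_mono nhdsWithin_le_nhds ?_
    refine ContinuousAt.eventually_lt (by fun_prop) (by fun_prop) ?_
    linarith
  have hIoo : ∀ᶠ t in 𝓝[>] (0 : ℝ), t ∈ Set.Ioo (0 : ℝ) 1 := Ioo_mem_nhdsGT one_pos
  obtain ⟨t, ht, hts⟩ := (hIoo.and hsmall).exists
  refine ⟨t, ht, lt_of_pow_lt_pow_left₀ 2 (norm_nonneg a) ?_⟩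
  have hvec : (1 - t) • a + t • b = a + t • (b - a) := by module
  rw [hvec, norm_add_sq_real, real_inner_smul_right, inner_sub_right, real_inner_self_eq_norm_sq,
    norm_smul, mul_pow, Real.norm_eq_abs, sq_abs, real_inner_comm]
  nlinarith [mul_neg_of_pos_of_neg ht.1 hts]

/-- The supremum of `⟪v, ·⟫` over the points of norm at most `r` in a dense set is `r * ‖v‖`. -/
theorem mul_norm_le_of_forall_inner_le {S : Set Y} (hS : Dense S) {r : ℝ} (hr : 0 < r) {v : Y}
    {c : ℝ} (h : ∀ y ∈ S ∩ Metric.closedBall 0 r, ⟪v, y⟫ ≤ c) : r * ‖v‖ ≤ c := by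
  have hcl : IsClosed {y : Y | ⟪v, y⟫ ≤ c} := isClosed_le (by fun_prop) (by fun_prop)
  have hball : Metric.ball (0 : Y) r ⊆ {y | ⟪v, y⟫ ≤ c} :=
    (hS.open_subset_closure_inter Metric.isOpen_ball).trans
      (closure_minimal (fun y hy => h y ⟨hy.2, Metric.ball_subset_closedBall hy.1⟩) hcl)
  have hcball : Metric.closedBall (0 : Y) r ⊆ {y | ⟪v, y⟫ ≤ c} :=
    closure_ball (0 : Y) hr.ne' ▸ closure_minimal hball hcl
  rcases eq_or_ne v 0 with rfl | hv
  · simpa using hcball (Metric.mem_closedBall_self hr.le)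
  have hv' : ‖v‖ ≠ 0 := norm_ne_zero_iff.mpr hv
  have hmem : (r / ‖v‖) • v ∈ Metric.closedBall (0 : Y) r := by
    rw [mem_closedBall_zero_iff, norm_smul, Real.norm_of_nonneg (by positivity),
      div_mul_cancel₀ _ hv']
  have := hcball hmem
  rw [Set.mem_ofPred_eq, real_inner_smul_right, real_inner_self_eq_norm_sq] at this
  convert this using 1
  field_simp

end Hilbert

/-- Theorem 2.1: if `x₀` is a common global minimum of `I` and `‖φ(·)‖` with `φ x₀ ≠ 0`,
and `inf_X ⟨φ(x), φ(x₀)⟩ < ‖φ(x₀)‖²`, then for every convex set `S ⊆ T` dense in `Y`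
there is `y* ∈ S` such that `x ↦ I x + ⟨φ x, y*⟩` has at least two global minima. -/
theorem ricceri_thm_2_1 {X : Type*} [TopologicalSpace X] {Y : Type*}
    [NormedAddCommGroup Y] [InnerProductSpace ℝ Y] [CompleteSpace Y]
    (T : Set Y) (hTconv : Convex ℝ T) (hTdense : Dense T)
    (I : X → ℝ) (φ : X → Y)
    (hlsc : ∀ y ∈ T, LowerSemicontinuous (fun x : X => I x + ⟪φ x, y⟫))
    (hinfcpt : ∀ y ∈ T, ∀ r : ℝ, IsCompact {x : X | I x + ⟪φ x, y⟫ ≤ r})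
    (x₀ : X) (hφx₀ : φ x₀ ≠ 0)
    (hImin : ∀ x : X, I x₀ ≤ I x)
    (hnormmin : ∀ x : X, ‖φ x₀‖ ≤ ‖φ x‖)
    (hb : ∃ x : X, ⟪φ x, φ x₀⟫ < ‖φ x₀‖ ^ 2) :
    ∀ S : Set Y, S ⊆ T → Convex ℝ S → Dense S →
      ∃ y' ∈ S, ∃ x₁ x₂ : X, x₁ ≠ x₂ ∧
        (∀ x : X, I x₁ + ⟪φ x₁, y'⟫ ≤ I x + ⟪φ x, y'⟫) ∧
        (∀ x : X, I x₂ + ⟪φ x₂, y'⟫ ≤ I x + ⟪φ x, y'⟫) := by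
  intro S hST hSconv hSdense
  by_contra hcon
  obtain ⟨x₁, hx₁⟩ := hb
  obtain ⟨t, ht, hnorm⟩ := exists_norm_segment_lt hx₁
  set w := (1 - t) • φ x₀ + t • φ x₁ with hw
  obtain ⟨r, hr, hrlt⟩ : ∃ r : ℝ, 0 < r ∧ t * (I x₁ - I x₀) < r * (‖φ x₀‖ - ‖w‖) := by
    have hlim : Tendsto (fun r : ℝ => r * (‖φ x₀‖ - ‖w‖)) atTop atTop :=
      tendsto_id.atTop_mul_const (sub_pos.mpr hnorm)
    exact ((eventually_gt_atTop 0).and (hlim.eventually_gt_atTop _)).exists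
  have : Nonempty X := ⟨x₀⟩
  have hKT : S ∩ Metric.closedBall 0 r ⊆ T := Set.inter_subset_left.trans hST
  have hKne : (S ∩ Metric.closedBall 0 r).Nonempty := by
    obtain ⟨y, hyb, hyS⟩ := hSdense.inter_open_nonempty _ Metric.isOpen_ball
      ⟨0, Metric.mem_ball_self hr⟩
    exact ⟨y, hyS, Metric.ball_subset_closedBall hyb⟩
  obtain ⟨x, hx⟩ := exists_forall_le_of_unique_min (I := I) (φ := φ)
    (c := (1 - t) * I x₀ + t * I x₁ + r * ‖w‖)
    (hSconv.inter (convex_closedBall 0 r)) hKne (fun y hy => hlsc y (hKT hy))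
    (fun y hy => hinfcpt y (hKT hy))
    (fun y hy z₁ z₂ h₁ h₂ => by
      by_contra hne
      exact hcon ⟨y, hy.1, z₁, z₂, hne, h₁, h₂⟩)
    (fun y hy => by
      by_contra! hgt
      have h0 := mul_lt_mul_of_pos_left (hgt x₀) (sub_pos.mpr ht.2)
      have h1 := mul_lt_mul_of_pos_left (hgt x₁) ht.1
      have h2 : ⟪w, y⟫ = (1 - t) * ⟪φ x₀, y⟫ + t * ⟪φ x₁, y⟫ := by
        rw [hw, inner_add_left, real_inner_smul_left, real_inner_smul_left]
      have h3 : ⟪w, y⟫ ≤ r * ‖w‖ := by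
        rw [mul_comm]
        exact (real_inner_le_norm w y).trans
          (mul_le_mul_of_nonneg_left (mem_closedBall_zero_iff.mp hy.2) (norm_nonneg w))
      linarith)
  have hsup := mul_norm_le_of_forall_inner_le hSdense hr
    (fun y hy => le_sub_iff_add_le'.mpr (hx y hy))
  have hmin := mul_le_mul_of_nonneg_left (hnormmin x) hr.le
  linarith [hImin x]
end

section
/- Let n ≥ 1 and let Ω ⊆ ℝⁿ be a bounded open set. Let P : Ω × ℝ² → ℝ be a function such that: (i) for each (s,t) ∈ ℝ², the function x ↦ P(x,s,t) is Lebesgue measurable on Ω; (ii) for almost every x ∈ Ω, the function (s,t) ↦ P(x,s,t) is continuous on ℝ²; (iii) P(x,0,0) = 0 for all x ∈ Ω; (iv) for every a > 0, sup_{x ∈ Ω, |s| ≤ a, |t| ≤ a} |P(x,s,t)| < +∞. Assume that the Lebesgue measure of the set D = {x ∈ Ω : there exists (s,t) ∈ ℝ² with P(x,s,t) < 0} is positive. Then there exist Lipschitz continuous functions ũ, ṽ : ℝⁿ → ℝ, each with compact support contained in Ω, such that ∫_Ω P(x, ũ(x), ṽ(x)) dx < 0. -/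
open MeasureTheory

open Filter Topology Set in
/-- The Nemytskii operator of a Carathéodory function preserves measurability. -/
theorem aemeasurable_comp_of_ae_continuous {X Y Z : Type*} [MeasurableSpace X] {μ : Measure X}
    [TopologicalSpace Y] [TopologicalSpace.PseudoMetrizableSpace Y]
    [MeasurableSpace Y] [BorelSpace Y] [SecondCountableTopology Y]
    [TopologicalSpace Z] [TopologicalSpace.PseudoMetrizableSpace Z]
    [MeasurableSpace Z] [BorelSpace Z]
    {P : X → Y → Z} (hmeas : ∀ y, AEMeasurable (fun x => P x y) μ)
    (hcont : ∀ᵐ x ∂μ, Continuous (P x)) {g : X → Y} (hg : Measurable g) :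
    AEMeasurable (fun x => P x (g x)) μ := by
  have hg' : StronglyMeasurable g := hg.stronglyMeasurable
  refine aemeasurable_of_tendsto_metrizable_ae' (f := fun m x => P x (hg'.approx m x))
    (fun m => ?_) ?_
  · refine ⟨fun x => (hmeas (hg'.approx m x)).mk _ x,
      SimpleFunc.measurable_bind _ (fun y => (hmeas y).mk _) fun y => (hmeas y).measurable_mk, ?_⟩
    have h : ∀ᵐ x ∂μ, ∀ y ∈ (hg'.approx m).range, P x y = (hmeas y).mk _ x := by
      rw [Filter.eventually_all_finset]
      exact fun y _ => (hmeas y).ae_eq_mk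
    filter_upwards [h] with x hx
    exact hx _ (SimpleFunc.mem_range_self _ x)
  · filter_upwards [hcont] with x hx
    exact (hx.tendsto _).comp (hg'.tendsto_approx x)

open TopologicalSpace in
/-- If `P x` takes a negative value for all `x` in a set of positive measure, and `P x` is a.e.
continuous, then `P · y` is negative on a set of positive measure for a single `y`. -/
theorem exists_measure_setOf_neg_pos {X Y : Type*} [MeasurableSpace X] {μ : Measure X}
    [TopologicalSpace Y] [SeparableSpace Y] {P : X → Y → ℝ}
    (hcont : ∀ᵐ x ∂μ, Continuous (P x)) (hD : μ {x | ∃ y, P x y < 0} ≠ 0) :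
    ∃ y, μ {x | P x y < 0} ≠ 0 := by
  by_contra! h
  refine hD ?_
  obtain ⟨S, hSc, hSd⟩ := exists_countable_dense Y
  have hS : ∀ᵐ x ∂μ, ∀ y ∈ S, ¬ P x y < 0 := by
    rw [ae_ball_iff hSc]
    intro y _
    simpa [ae_iff] using h y
  have : ∀ᵐ x ∂μ, ¬ ∃ y, P x y < 0 := by
    filter_upwards [hcont, hS] with x hx hxS ⟨y, hy⟩
    obtain ⟨z, hz, hzS⟩ := hSd.inter_open_nonempty _ (isOpen_lt hx continuous_const) ⟨y, hy⟩
    exact hxS z hzS hz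
  simpa [ae_iff] using this

open Filter Topology Set in
/-- Indicators of compact sets are pointwise limits of Lipschitz functions with compact support
in a given neighbourhood. -/
theorem IsCompact.exists_lipschitz_tendsto_indicator {E : Type*} [PseudoMetricSpace E] [T2Space E]
    [ProperSpace E] {K U : Set E} (hK : IsCompact K) (hU : IsOpen U) (hKU : K ⊆ U) :
    ∃ φ : ℕ → E → ℝ, (∀ k, ∃ C : NNReal, LipschitzWith C (φ k)) ∧
      (∀ k, HasCompactSupport (φ k)) ∧ (∀ k, tsupport (φ k) ⊆ U) ∧
      (∀ k x, |φ k x| ≤ 1) ∧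
      ∀ x, Tendsto (fun k => φ k x) atTop (𝓝 (K.indicator (fun _ => 1) x)) := by
  obtain ⟨δ, hδ, hδU⟩ := hK.exists_cthickening_subset_open hU hKU
  have hpos : ∀ k : ℕ, 0 < δ / (k + 1) := fun k => by positivity
  have hlim : Tendsto (fun k : ℕ => δ / ((k : ℝ) + 1)) atTop (𝓝 0) := by
    simpa [div_eq_mul_inv] using tendsto_one_div_add_atTop_nhds_zero_nat.const_mul δ
  have hsupp : ∀ k, tsupport (fun x => (thickenedIndicator (hpos k) K x : ℝ))
      ⊆ Metric.cthickening δ K := fun k => by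
    refine closure_minimal (fun x hx => ?_) Metric.isClosed_cthickening
    by_contra hx'
    refine hx ?_
    have hle : δ / ((k : ℝ) + 1) ≤ δ := div_le_self hδ.le (by simp)
    have hxk : x ∉ Metric.thickening (δ / ((k : ℝ) + 1)) K := fun h =>
      hx' (Metric.thickening_subset_cthickening _ _ (Metric.thickening_mono hle K h))
    simp only [thickenedIndicator_zero (hpos k) K hxk, NNReal.coe_zero]
  refine ⟨fun k x => thickenedIndicator (hpos k) K x,
    fun k => ⟨_, NNReal.isometry_coe.lipschitz.comp (lipschitzWith_thickenedIndicator (hpos k) K)⟩,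
    fun k => hK.cthickening.of_isClosed_subset (isClosed_tsupport _) (hsupp k),
    fun k => (hsupp k).trans hδU, fun k x => ?_, fun x => ?_⟩
  · rw [NNReal.abs_eq]
    exact_mod_cast thickenedIndicator_le_one (hpos k) K x
  · have h := tendsto_pi_nhds.1 (thickenedIndicator_tendsto_indicator_closure hpos hlim K) x
    rw [hK.isClosed.closure_eq] at h
    have h' := (NNReal.continuous_coe.tendsto _).comp h
    by_cases hx : x ∈ K <;> simpa [hx, Function.comp_def] using h'

/-- If `P : Ω × ℝ² → ℝ` is a Carathéodory-type integrand vanishing at `(0,0)`, bounded on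
bounded sets, and negative somewhere in `(s,t)` for a set of `x` of positive measure, then
one can find Lipschitz functions `ũ, ṽ` with compact support contained in `Ω` such that
`∫_Ω P(x, ũ(x), ṽ(x)) dx < 0`. -/
theorem ricceri_negative_integral (n : ℕ) (hn : 1 ≤ n)
    (Ω : Set (EuclideanSpace ℝ (Fin n))) (hΩopen : IsOpen Ω)
    (hΩbdd : Bornology.IsBounded Ω)
    (P : EuclideanSpace ℝ (Fin n) → ℝ × ℝ → ℝ)
    (hmeas : ∀ st : ℝ × ℝ, Measurable fun x : Ω => P x st)
    (hcont : ∀ᵐ x ∂(volume.restrict Ω), Continuous fun st : ℝ × ℝ => P x st)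
    (hzero : ∀ x ∈ Ω, P x (0, 0) = 0)
    (hbdd : ∀ a : ℝ, 0 < a → ∃ M : ℝ, ∀ x ∈ Ω, ∀ s t : ℝ,
      |s| ≤ a → |t| ≤ a → |P x (s, t)| ≤ M)
    (hD : 0 < volume {x ∈ Ω | ∃ st : ℝ × ℝ, P x st < 0}) :
    ∃ u v : EuclideanSpace ℝ (Fin n) → ℝ,
      (∃ K : NNReal, LipschitzWith K u) ∧ (∃ K : NNReal, LipschitzWith K v) ∧
      HasCompactSupport u ∧ HasCompactSupport v ∧
      tsupport u ⊆ Ω ∧ tsupport v ⊆ Ω ∧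
      ∫ x in Ω, P x (u x, v x) < 0 := by
  have hΩm := hΩopen.measurableSet
  have hP : ∀ st, AEMeasurable (fun x => P x st) (volume.restrict Ω) := fun st =>
    aemeasurable_restrict_of_measurable_subtype hΩm (hmeas st)
  have : IsFiniteMeasure (volume.restrict Ω) := ⟨by
    simpa using hΩbdd.measure_lt_top⟩
  obtain ⟨⟨s, t⟩, hst⟩ := exists_measure_setOf_neg_pos hcont (by
    rw [Measure.restrict_apply' hΩm, Set.inter_comm]
    exact hD.ne')
  have hA : MeasurableSet (Subtype.val '' {x : Ω | P x (s, t) < 0}) :=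
    (MeasurableEmbedding.subtype_coe hΩm).measurableSet_image.2
      (measurableSet_lt (hmeas _) measurable_const)
  have hAeq : Subtype.val '' {x : Ω | P x (s, t) < 0} = {x | P x (s, t) < 0} ∩ Ω := by
    ext x
    simp [and_comm]
  rw [hAeq] at hA
  rw [Measure.restrict_apply' hΩm] at hst
  obtain ⟨K, hKA, hK, hKpos⟩ := hA.exists_lt_isCompact (pos_iff_ne_zero.2 hst)
  have hKΩ : K ⊆ Ω := fun x hx => (hKA hx).2
  obtain ⟨φ, hφL, hφc, hφs, hφ1, hφlim⟩ := hK.exists_lipschitz_tendsto_indicator hΩopen hKΩ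
  obtain ⟨M, hM⟩ := hbdd (|s| + |t| + 1) (by positivity)
  have hφm : ∀ k, Measurable (φ k) := fun k => by
    obtain ⟨C, hC⟩ := hφL k
    exact hC.continuous.measurable
  have hmul : ∀ c y a : ℝ, |y| ≤ 1 → |c| ≤ a → |c * y| ≤ a := fun c y a hy hc => by
    rw [abs_mul]
    exact (mul_le_of_le_one_right (abs_nonneg c) hy).trans hc
  have hs : |s| ≤ |s| + |t| + 1 := by linarith [abs_nonneg t]
  have ht : |t| ≤ |s| + |t| + 1 := by linarith [abs_nonneg s]
  have hlim : Filter.Tendsto (fun k => ∫ x in Ω, P x (s * φ k x, t * φ k x)) Filter.atTop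
      (nhds (∫ x in Ω, K.indicator (fun x => P x (s, t)) x)) := by
    refine tendsto_integral_of_dominated_convergence (fun _ => M) (fun k => ?_)
      (integrable_const M) (fun k => ?_) ?_
    · exact (aemeasurable_comp_of_ae_continuous hP hcont
        (((hφm k).const_mul s).prodMk ((hφm k).const_mul t))).aestronglyMeasurable
    · filter_upwards [ae_restrict_mem hΩm] with x hx
      exact hM x hx _ _ (hmul _ _ _ (hφ1 k x) hs) (hmul _ _ _ (hφ1 k x) ht)
    · filter_upwards [hcont, ae_restrict_mem hΩm] with x hx hxΩ
      have h := (hx.tendsto _).comp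
        (((hφlim x).const_mul s).prodMk_nhds ((hφlim x).const_mul t))
      by_cases hxK : x ∈ K
      · simpa [hxK, Function.comp_def] using h
      · simpa [hxK, Function.comp_def, hzero x hxΩ] using h
  have hneg : ∫ x in Ω, K.indicator (fun x => P x (s, t)) x < 0 := by
    have hKm := hK.measurableSet
    have hint : IntegrableOn (fun x => P x (s, t)) K := by
      refine IntegrableOn.mono_set (t := Ω) ?_ hKΩ
      refine (integrable_const M).mono' (hP _).aestronglyMeasurable ?_
      filter_upwards [ae_restrict_mem hΩm] with x hx
      exact hM x hx _ _ hs ht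
    rw [setIntegral_indicator hKm, Set.inter_eq_right.2 hKΩ, ← neg_pos, ← integral_neg]
    refine (setIntegral_pos_iff_support_of_nonneg_ae ?_ hint.neg).2 ?_
    · filter_upwards [ae_restrict_mem hKm] with x hx
      exact (neg_pos.2 (hKA hx).1).le
    · refine hKpos.trans_le (measure_mono fun x hx => ⟨?_, hx⟩)
      exact (neg_pos.2 (hKA hx).1).ne'
  obtain ⟨k, hk⟩ := (hlim.eventually (gt_mem_nhds hneg)).exists
  have hLip : ∀ c : ℝ, ∃ C : NNReal, LipschitzWith C fun x => c * φ k x := fun c => by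
    obtain ⟨C, hC⟩ := hφL k
    exact ⟨_, (lipschitzWith_smul c).comp hC⟩
  have hsub : ∀ c : ℝ, tsupport (fun x => c * φ k x) ⊆ Ω := fun c =>
    (tsupport_mul_subset_right (f := fun _ => c) (g := φ k)).trans (hφs k)
  exact ⟨fun x => s * φ k x, fun x => t * φ k x, hLip s, hLip t,
    (hφc k).mul_left (f := fun _ => s), (hφc k).mul_left (f := fun _ => t), hsub s, hsub t, hk⟩
end
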